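/- arXiv:2411.04084 — 2 statements merged into one kernel-verified Lean document; each statement's English description precedes it below -/
import Mathlib

section
/- There exists R₀ > 2 (depending only on m_v and m_z) such that for every R > R₀ there is a constant C > 0, depending only on m_v, m_z, R₀ and R, with the following property: for every function t : (R₀, R) → (0, 1/ρ²) and all s, s' ∈ (R₀, R) with s ≠ s', the improper integral lim_{T→∞} ∫_{1/R₀}^{T} exp(i[λ(s'−s) + (t(s')−t(s))(λ²+ρ²)]) · (λ²+ρ²)^{−1/4} dλ converges, and its modulus is at most C(|s−s'|^{−1/2} + 1). -/
open MeasureTheory Filter Set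

noncomputable section

/-- The half-sum of roots `ρ = Q/2 = (m_v/2 + m_z)/2` of a Damek–Ricci space
built from an H-type algebra with `dim 𝔳 = m_v` and `dim 𝔷 = m_z`. -/
def rhoDR (mv mz : ℕ) : ℝ := ((mv : ℝ) / 2 + mz) / 2

end

noncomputable section

def gDR (r l : ℝ) : ℝ := (l ^ 2 + r ^ 2) ^ (-(1 / 4) : ℝ)

def fDR (a b r l : ℝ) : ℂ :=
  Complex.exp (Complex.I * ((l * a + b * (l ^ 2 + r ^ 2) : ℝ) : ℂ)) * ((gDR r l : ℝ) : ℂ)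

end

lemma gDR_deriv {r : ℝ} (hr : 0 < r) (l : ℝ) :
    HasDerivAt (gDR r) (2 * l * (-(1 / 4)) * (l ^ 2 + r ^ 2) ^ (-(1 / 4) - 1 : ℝ)) l := by
  have h : HasDerivAt (fun l : ℝ => l ^ 2 + r ^ 2) (2 * l) l := by
    simpa using (hasDerivAt_pow 2 l).add_const (r ^ 2)
  exact h.rpow_const (Or.inl (by positivity))

lemma gDR_nonneg (r l : ℝ) : 0 ≤ gDR r l := by unfold gDR; positivity

lemma gDR_le {r l : ℝ} (hr : 0 < r) (hl : 0 < l) : gDR r l ≤ 1 / √l := by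
  have h1 : gDR r l ≤ (l ^ 2) ^ (-(1 / 4) : ℝ) := by
    unfold gDR
    apply Real.rpow_le_rpow_of_nonpos (by positivity) (by nlinarith) (by norm_num)
  have h2 : (l ^ 2) ^ (-(1 / 4) : ℝ) = 1 / √l := by
    rw [← Real.rpow_natCast, ← Real.rpow_mul hl.le, Real.sqrt_eq_rpow,
      one_div (l ^ (1 / 2 : ℝ)), ← Real.rpow_neg hl.le]
    norm_num
  rw [← h2]; exact h1

lemma gDR_anti {r x y : ℝ} (hr : 0 < r) (hx : 0 ≤ x) (hxy : x ≤ y) : gDR r y ≤ gDR r x := by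
  unfold gDR
  apply Real.rpow_le_rpow_of_nonpos (by positivity) (by nlinarith) (by norm_num)

lemma fDR_cont (a b : ℝ) {r : ℝ} (hr : 0 < r) : Continuous (fDR a b r) := by
  have : Continuous (gDR r) :=
    continuous_iff_continuousAt.2 fun l => (gDR_deriv hr l).continuousAt
  unfold fDR
  fun_prop

lemma exp_norm (x : ℝ) : ‖Complex.exp (Complex.I * (x : ℂ))‖ = 1 := by
  rw [mul_comm]; exact Complex.norm_exp_ofReal_mul_I x

lemma fDR_norm (a b r l : ℝ) : ‖fDR a b r l‖ = gDR r l := by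
  unfold fDR
  rw [norm_mul, exp_norm, one_mul, Complex.norm_real, Real.norm_of_nonneg (gDR_nonneg r l)]

/-- first derivative test -/
lemma fdt {a b r p q μ : ℝ} (hr : 0 < r) (hp : 0 < p) (hpq : p ≤ q) (hμ : 0 < μ)
    (h : ∀ l ∈ Icc p q, μ ≤ |a + 2 * b * l|) :
    ‖∫ l in p..q, fDR a b r l‖ ≤ 5 * gDR r p / μ := by
  set e : ℝ → ℂ := fun l => Complex.exp (Complex.I * ((l * a + b * (l ^ 2 + r ^ 2) : ℝ) : ℂ)) with he
  set ψ : ℝ → ℝ := fun l => a + 2 * b * l with hψ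
  set g' : ℝ → ℝ := fun l => 2 * l * (-(1 / 4)) * (l ^ 2 + r ^ 2) ^ (-(1 / 4) - 1 : ℝ) with hg'
  have hgd : ∀ l, HasDerivAt (gDR r) (g' l) l := gDR_deriv hr
  have hg'np : ∀ l, p ≤ l → g' l ≤ 0 := by
    intro l hl
    have : 0 ≤ l := hp.le.trans hl
    have h2 : 0 ≤ l * (l ^ 2 + r ^ 2) ^ (-(1 / 4) - 1 : ℝ) := by positivity
    simp only [hg']; nlinarith
  have hψ0 : ∀ l ∈ Icc p q, ψ l ≠ 0 := by
    intro l hl h0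
    have := h l hl
    simp only [hψ] at h0
    rw [h0, abs_zero] at this; linarith
  have hψd : ∀ l, HasDerivAt ψ (2 * b) l := by
    intro l
    simpa [hψ] using ((hasDerivAt_id l).const_mul (2 * b)).const_add a
  have hed : ∀ l, HasDerivAt e (Complex.I * (ψ l : ℂ) * e l) l := by
    intro l
    have h1 : HasDerivAt (fun l : ℝ => l * a + b * (l ^ 2 + r ^ 2)) (ψ l) l := by
      have := ((hasDerivAt_id l).mul_const a).add
        (((hasDerivAt_pow 2 l).add_const (r ^ 2)).const_mul b)
      refine HasDerivAt.congr_deriv this ?_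
      simp [hψ]; ring
    have h2 := (h1.ofReal_comp.const_mul Complex.I).cexp
    refine HasDerivAt.congr_deriv h2 ?_
    simp only [he]; ring
  set hh : ℝ → ℝ := fun l => gDR r l / ψ l with hhh
  have hhd : ∀ l ∈ Icc p q,
      HasDerivAt hh ((g' l * ψ l - gDR r l * (2 * b)) / ψ l ^ 2) l := fun l hl =>
    (hgd l).div (hψd l) (hψ0 l hl)
  set F : ℝ → ℂ := fun l => -Complex.I * (e l * (hh l : ℂ)) with hF
  have hFd : ∀ l ∈ Icc p q, HasDerivAt F (fDR a b r l +
      -Complex.I * (e l * (((g' l * ψ l - gDR r l * (2 * b)) / ψ l ^ 2 : ℝ) : ℂ))) l := by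
    intro l hl
    have h1 := ((hed l).mul (hhd l hl).ofReal_comp).const_mul (-Complex.I)
    refine HasDerivAt.congr_deriv h1 ?_
    have hne : (ψ l : ℂ) ≠ 0 := by exact_mod_cast hψ0 l hl
    have hI : Complex.I * Complex.I = -1 := Complex.I_mul_I
    have : fDR a b r l = e l * (gDR r l : ℂ) := rfl
    rw [this, mul_add]
    symm
    congr 1
    simp only [hhh]
    push_cast
    field_simp
    rw [Complex.I_sq]; ring
  have hcont := fDR_cont a b hr
  set G : ℝ → ℂ := fun x => (∫ l in p..x, fDR a b r l) - F x + F p with hG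
  have hGd : ∀ l ∈ Icc p q, HasDerivAt G (Complex.I *
      (e l * (((g' l * ψ l - gDR r l * (2 * b)) / ψ l ^ 2 : ℝ) : ℂ))) l := by
    intro l hl
    have h1 := ((hcont.integral_hasStrictDerivAt p l).hasDerivAt.sub (hFd l hl)).add_const (F p)
    refine HasDerivAt.congr_deriv h1 ?_
    ring
  obtain ⟨σ, hσ, hσ1⟩ : ∃ σ : ℝ, |b| = σ * b ∧ |σ| = 1 := by
    rcases le_total 0 b with hb | hb
    · exact ⟨1, by rw [abs_of_nonneg hb, one_mul], by simp⟩
    · exact ⟨-1, by rw [abs_of_nonpos hb]; ring, by simp⟩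
  set B : ℝ → ℝ := fun x => (gDR r p - gDR r x) / μ + gDR r p * σ * ((ψ p)⁻¹ - (ψ x)⁻¹) with hB
  have hBd : ∀ l ∈ Icc p q, HasDerivAt B (-g' l / μ + gDR r p * σ * (2 * b / ψ l ^ 2)) l := by
    intro l hl
    have h1 := (((hgd l).const_sub (gDR r p)).div_const μ).add
      ((((hψd l).inv (hψ0 l hl)).const_sub (ψ p)⁻¹).const_mul (gDR r p * σ))
    refine HasDerivAt.congr_deriv h1 ?_
    ring
  have hpI : p ∈ Icc p q := ⟨le_rfl, hpq⟩
  have hqI : q ∈ Icc p q := ⟨hpq, le_rfl⟩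
  have key : ‖G q‖ ≤ B q := by
    refine image_norm_le_of_norm_deriv_right_le_deriv_boundary' (f := G) (a := p) (b := q)
      (fun l hl => (hGd l hl).continuousAt.continuousWithinAt)
      (fun l hl => (hGd l ⟨hl.1, hl.2.le⟩).hasDerivWithinAt) ?_
      (fun l hl => (hBd l hl).continuousAt.continuousWithinAt)
      (fun l hl => (hBd l ⟨hl.1, hl.2.le⟩).hasDerivWithinAt) ?_ hqI
    · simp [hG, hB]
    · intro l hl
      have hlI : l ∈ Icc p q := ⟨hl.1, hl.2.le⟩
      have hnz := hψ0 l hlI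
      have hμl : μ ≤ |ψ l| := h l hlI
      rw [norm_mul, norm_mul, Complex.norm_I, one_mul, exp_norm, one_mul, Complex.norm_real,
        Real.norm_eq_abs]
      have : (g' l * ψ l - gDR r l * (2 * b)) / ψ l ^ 2
          = g' l / ψ l - gDR r l * (2 * b) / ψ l ^ 2 := by field_simp
      rw [this]
      refine (abs_sub _ _).trans (add_le_add ?_ ?_)
      · rw [abs_div, abs_of_nonpos (hg'np l hl.1)]
        exact div_le_div_of_nonneg_left (by linarith [hg'np l hl.1]) hμ hμl
      · rw [abs_div, abs_mul, abs_of_nonneg (gDR_nonneg r l), abs_mul, hσ,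
          abs_of_nonneg (sq_nonneg (ψ l)), abs_two]
        have h3 : gDR r l ≤ gDR r p := gDR_anti hr hp.le hl.1
        have h4 : 0 ≤ σ * b := hσ ▸ abs_nonneg b
        calc gDR r l * (2 * (σ * b)) / ψ l ^ 2 ≤ gDR r p * (2 * (σ * b)) / ψ l ^ 2 := by gcongr
          _ = _ := by ring
  have hFn : ∀ l ∈ Icc p q, ‖F l‖ ≤ gDR r p / μ := by
    intro l hl
    have hμl : μ ≤ |ψ l| := h l hl
    simp only [hF, hhh]
    rw [norm_mul, norm_mul, norm_neg, Complex.norm_I, one_mul, exp_norm, one_mul,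
      Complex.norm_real, Real.norm_eq_abs, abs_div, abs_of_nonneg (gDR_nonneg r l)]
    exact div_le_div₀ (gDR_nonneg _ _) (gDR_anti hr hp.le hl.1) hμ hμl
  have hBq : B q ≤ 3 * (gDR r p / μ) := by
    have hi : ∀ l ∈ Icc p q, |(ψ l)⁻¹| ≤ μ⁻¹ := by
      intro l hl
      rw [abs_inv]
      exact inv_anti₀ hμ (h l hl)
    have h1 : σ * ((ψ p)⁻¹ - (ψ q)⁻¹) ≤ 2 * μ⁻¹ := by
      refine (le_abs_self _).trans ?_
      rw [abs_mul, hσ1, one_mul]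
      refine (abs_sub _ _).trans ?_
      linarith [hi p hpI, hi q hqI]
    have h2 : (gDR r p - gDR r q) / μ ≤ gDR r p / μ := by
      gcongr; linarith [gDR_nonneg r q]
    have h3 := mul_le_mul_of_nonneg_left h1 (gDR_nonneg r p)
    simp only [hB]
    calc _ ≤ gDR r p / μ + gDR r p * (2 * μ⁻¹) := by rw [mul_assoc]; exact add_le_add h2 h3
      _ = _ := by ring
  have hfin : (∫ l in p..q, fDR a b r l) = G q + F q - F p := by simp only [hG]; ring
  rw [hfin]
  calc ‖G q + F q - F p‖ ≤ ‖G q‖ + ‖F q‖ + ‖F p‖ :=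
        (norm_sub_le _ _).trans (by gcongr; exact norm_add_le _ _)
    _ ≤ 3 * (gDR r p / μ) + gDR r p / μ + gDR r p / μ := by
        gcongr
        · exact key.trans hBq
        · exact hFn q hqI
        · exact hFn p hpI
    _ = _ := by ring

lemma triv_sqrt {a b r p q : ℝ} (hr : 0 < r) (hp : 0 < p) (hpq : p ≤ q) :
    ‖∫ l in p..q, fDR a b r l‖ ≤ 2 * √q := by
  have hcont := fDR_cont a b hr
  have key : ‖∫ l in p..q, fDR a b r l‖ ≤ 2 * √q - 2 * √p := by
    have hd : ∀ l ∈ Icc p q, HasDerivAt (fun l => 2 * √l - 2 * √p) (1 / √l) l := by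
      intro l hl
      have hl0 : l ≠ 0 := (hp.trans_le hl.1).ne'
      have := ((Real.hasDerivAt_sqrt hl0).const_mul 2).sub_const (2 * √p)
      refine HasDerivAt.congr_deriv this ?_
      ring
    refine image_norm_le_of_norm_deriv_right_le_deriv_boundary' (a := p) (b := q)
      (f := fun x => ∫ l in p..x, fDR a b r l) (f' := fDR a b r) (B := fun l => 2 * √l - 2 * √p)
      (fun l hl => (hcont.integral_hasStrictDerivAt p l).hasDerivAt.continuousAt.continuousWithinAt)
      (fun l hl => (hcont.integral_hasStrictDerivAt p l).hasDerivAt.hasDerivWithinAt) ?_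
      (fun l hl => (hd l hl).continuousAt.continuousWithinAt)
      (fun l hl => (hd l ⟨hl.1, hl.2.le⟩).hasDerivWithinAt) ?_ ⟨hpq, le_rfl⟩
    · simp
    · intro l hl
      rw [fDR_norm]
      exact gDR_le hr (hp.trans_le hl.1)
  linarith [Real.sqrt_nonneg p]

lemma triv_len {a b r p q M : ℝ} (hr : 0 < r) (hp : 0 < p) (hpq : p ≤ q) (hM : gDR r p ≤ M) :
    ‖∫ l in p..q, fDR a b r l‖ ≤ M * (q - p) := by
  have := intervalIntegral.norm_integral_le_of_norm_le_const (a := p) (b := q) (C := M)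
    (f := fDR a b r) (fun l hl => by
      rw [uIoc_of_le hpq] at hl
      rw [fDR_norm]
      exact (gDR_anti hr hp.le hl.1.le).trans hM)
  rwa [abs_of_nonneg (by linarith)] at this

lemma gDR_le' {r x y : ℝ} (hr : 0 < r) (hy : 0 < y) (hxy : y ^ 2 ≤ x) : gDR r x ≤ 1 / y := by
  have hx : 0 < x := lt_of_lt_of_le (by positivity) hxy
  refine (gDR_le hr hx).trans ?_
  apply one_div_le_one_div_of_le hy
  exact Real.le_sqrt_of_sq_le hxy

/-- first piece -/
lemma piece1 {a b r A δ : ℝ} (hr : 0 < r) (hδ : 0 < δ) (hA : 0 < A) :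
    ‖∫ l in δ..(max δ ((1 / A) ^ 2)), fDR a b r l‖ ≤ 2 / A := by
  rcases le_total δ ((1 / A) ^ 2) with h | h
  · rw [max_eq_right h]
    refine (triv_sqrt hr hδ h).trans ?_
    rw [Real.sqrt_sq (by positivity)]
    apply le_of_eq; ring
  · rw [max_eq_left h]; simp; positivity

lemma core {a b r A δ : ℝ} (hr : 0 < r) (hδ : 0 < δ) (hA : 0 < A) (ha : |a| = A ^ 2) :
    ∃ c μ : ℝ, δ ≤ c ∧ 0 < μ ∧ (∀ l, c ≤ l → μ ≤ |a + 2 * b * l|) ∧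
      ‖∫ l in δ..c, fDR a b r l‖ ≤ 21 / A ∧ 5 * gDR r c / μ ≤ 10 / A := by
  have hp1 := piece1 (a := a) (b := b) hr hδ hA
  set c1 := max δ ((1 / A) ^ 2) with hc1
  have hc1δ : δ ≤ c1 := le_max_left _ _
  have hc10 : 0 < c1 := hδ.trans_le hc1δ
  have hgc1 : gDR r c1 ≤ A := by
    have := gDR_le' (r := r) (x := c1) (y := 1 / A) hr (by positivity) (le_max_right _ _)
    simpa using this
  by_cases hab : 0 ≤ a * b
  · refine ⟨c1, A ^ 2, hc1δ, by positivity, ?_, hp1.trans (by gcongr; norm_num), ?_⟩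
    · intro l hl
      rw [← ha]
      apply sq_le_sq.1
      have : 0 ≤ a * b * l := mul_nonneg hab (hc10.le.trans hl)
      nlinarith [sq_nonneg (b * l)]
    · rw [div_le_div_iff₀ (by positivity) hA]
      nlinarith [gDR_nonneg r c1, mul_le_mul_of_nonneg_right hgc1 hA.le, sq_nonneg A]
  push Not at hab
  have hb0 : b ≠ 0 := by rintro rfl; simp at hab
  obtain ⟨β, hβ, hbβ⟩ : ∃ β : ℝ, 0 < β ∧ |b| = β ^ 2 :=
    ⟨√|b|, by positivity, (Real.sq_sqrt (abs_nonneg b)).symm⟩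
  have hφ : ∀ l, |a + 2 * b * l| = |A ^ 2 - 2 * β ^ 2 * l| := by
    intro l
    rcases lt_or_gt_of_ne hb0 with hb | hb
    · have ha' : 0 < a := by nlinarith
      rw [abs_of_pos ha'] at ha
      rw [abs_of_neg hb] at hbβ
      rw [← ha, ← hbβ]; congr 1; ring
    · have ha' : a < 0 := by nlinarith
      rw [abs_of_neg ha'] at ha
      rw [abs_of_pos hb] at hbβ
      rw [← ha, ← hbβ, ← abs_neg]; congr 1; ring
  have hsq : (A / (2 * β)) ^ 2 * (4 * β ^ 2) = A ^ 2 := by field_simp; ring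
  set y := A / (2 * β) with hy
  have hy0 : 0 < y := by positivity
  have hη : 1 / β * β = 1 := by field_simp
  set η := 1 / β with hηd
  have hη0 : 0 < η := by positivity
  have hηβ : η * β ^ 2 = β := by rw [pow_two, ← mul_assoc, hη, one_mul]
  have hyinv : 1 / y = 2 * β / A := by rw [hy, one_div_div]
  -- critical point is 2 * y ^ 2
  set c2 := max c1 (y ^ 2) with hc2
  set c3 := max c2 (2 * y ^ 2 - η) with hc3
  set c4 := max c3 (2 * y ^ 2 + η) with hc4
  have h12 : c1 ≤ c2 := le_max_left _ _
  have h23 : c2 ≤ c3 := le_max_left _ _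
  have h34 : c3 ≤ c4 := le_max_left _ _
  have hgc : ∀ x, y ^ 2 ≤ x → gDR r x ≤ 2 * β / A := fun x hx => by
    rw [← hyinv]; exact gDR_le' hr hy0 hx
  have hy2 : y ^ 2 ≤ c2 := le_max_right _ _
  have hfin : 5 * (2 * β / A) / (2 * β) = 5 / A := by field_simp
  have p2 : ‖∫ l in c1..c2, fDR a b r l‖ ≤ 10 / A := by
    rcases le_total c1 (y ^ 2) with h | h
    · have : c2 = y ^ 2 := max_eq_right h
      rw [this]
      refine (fdt (μ := A ^ 2 / 2) hr hc10 h (by positivity) ?_).trans ?_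
      · intro l hl
        rw [hφ]
        refine le_trans ?_ (le_abs_self _)
        nlinarith [mul_le_mul_of_nonneg_right hl.2 (sq_nonneg β)]
      · rw [div_le_div_iff₀ (by positivity) hA]
        nlinarith [gDR_nonneg r c1, mul_le_mul_of_nonneg_right hgc1 hA.le, sq_nonneg A]
    · have : c2 = c1 := max_eq_left h
      rw [this]; simp; positivity
  have p3 : ‖∫ l in c2..c3, fDR a b r l‖ ≤ 5 / A := by
    rcases le_total c2 (2 * y ^ 2 - η) with h | h
    · have : c3 = 2 * y ^ 2 - η := max_eq_right h
      rw [this]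
      refine (fdt (μ := 2 * β) hr (hc10.trans_le h12) h (by positivity) ?_).trans ?_
      · intro l hl
        rw [hφ]
        refine le_trans ?_ (le_abs_self _)
        nlinarith [mul_le_mul_of_nonneg_right hl.2 (sq_nonneg β)]
      · rw [← hfin]
        gcongr
        exact hgc _ hy2
    · have : c3 = c2 := max_eq_left h
      rw [this]; simp; positivity
  have p4 : ‖∫ l in c3..c4, fDR a b r l‖ ≤ 4 / A := by
    refine (triv_len hr (hc10.trans_le (h12.trans h23)) h34
      (hgc c3 (hy2.trans h23))).trans ?_
    have hlen : c4 - c3 ≤ 2 * η := by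
      have h1 : 2 * y ^ 2 - η ≤ c3 := le_max_right _ _
      have h2 : c4 ≤ c3 + 2 * η := max_le (by linarith) (by linarith)
      linarith
    calc 2 * β / A * (c4 - c3) ≤ 2 * β / A * (2 * η) := by gcongr
      _ = 4 * (η * β) / A := by ring
      _ = _ := by rw [hη, mul_one]
  refine ⟨c4, 2 * β, hc1δ.trans (h12.trans (h23.trans h34)), by positivity, ?_, ?_, ?_⟩
  · intro l hl
    rw [hφ]
    refine le_trans ?_ (neg_le_abs _)
    have : 2 * y ^ 2 + η ≤ l := (le_max_right _ _).trans hl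
    nlinarith [mul_le_mul_of_nonneg_right this (sq_nonneg β)]
  · have hi : ∀ x y, IntervalIntegrable (fDR a b r) volume x y := fun x y =>
      (fDR_cont a b hr).intervalIntegrable x y
    rw [← intervalIntegral.integral_add_adjacent_intervals (hi δ c3) (hi c3 c4),
      ← intervalIntegral.integral_add_adjacent_intervals (hi δ c2) (hi c2 c3),
      ← intervalIntegral.integral_add_adjacent_intervals (hi δ c1) (hi c1 c2)]
    refine norm_add₄_le.trans ?_
    have : 21 / A = 2 / A + 10 / A + 5 / A + 4 / A := by ring
    rw [this]
    gcongr
  · calc 5 * gDR r c4 / (2 * β) ≤ 5 * (2 * β / A) / (2 * β) := by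
          gcongr
          exact hgc _ (hy2.trans (h23.trans h34))
      _ = 5 / A := hfin
      _ ≤ _ := by gcongr; norm_num

lemma gDR_tendsto {r : ℝ} (hr : 0 < r) : Tendsto (gDR r) atTop (nhds 0) := by
  have h1 : Tendsto (fun l : ℝ => 1 / √l) atTop (nhds 0) := by
    simp only [one_div]
    exact tendsto_inv_atTop_zero.comp Real.tendsto_sqrt_atTop
  refine squeeze_zero' (Eventually.of_forall fun l => gDR_nonneg r l) ?_ h1
  filter_upwards [eventually_gt_atTop 0] with l hl using gDR_le hr hl

lemma osc {a b r A δ : ℝ} (hr : 0 < r) (hδ : 0 < δ) (hA : 0 < A) (ha : |a| = A ^ 2) :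
    ∃ L : ℂ, Tendsto (fun T : ℝ => ∫ l in Set.Ioc δ T, fDR a b r l) atTop (nhds L) ∧
      ‖L‖ ≤ 31 / A := by
  obtain ⟨c, μ, hc, hμ, hφ, h1, h2⟩ := core (b := b) hr hδ hA ha
  have hi : ∀ x y, IntervalIntegrable (fDR a b r) volume x y := fun x y =>
    (fDR_cont a b hr).intervalIntegrable x y
  have hc0 := hδ.trans_le hc
  have heq : (fun T : ℝ => ∫ l in δ..T, fDR a b r l) =ᶠ[atTop]
      (fun T : ℝ => ∫ l in Set.Ioc δ T, fDR a b r l) := by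
    filter_upwards [eventually_ge_atTop δ] with T hT
    rw [intervalIntegral.integral_of_le hT]
  have hcau : CauchySeq (fun T : ℝ => ∫ l in δ..T, fDR a b r l) := by
    rw [Metric.cauchySeq_iff']
    intro ε hε
    have ht : Tendsto (fun T => 5 * gDR r T / μ) atTop (nhds 0) := by
      simpa using ((gDR_tendsto hr).const_mul 5).div_const μ
    obtain ⟨N, hN1, hN2⟩ := ((ht.eventually (gt_mem_nhds hε)).and (eventually_ge_atTop c)).exists
    refine ⟨N, fun T hT => ?_⟩
    rw [dist_eq_norm, intervalIntegral.integral_interval_sub_left (hi _ _) (hi _ _)]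
    exact (fdt hr (hc0.trans_le hN2) hT hμ fun l hl => hφ l (hN2.trans hl.1)).trans_lt hN1
  obtain ⟨L, hL⟩ := cauchySeq_tendsto_of_complete hcau
  refine ⟨L, hL.congr' heq, ?_⟩
  refine le_of_tendsto hL.norm ?_
  filter_upwards [eventually_ge_atTop c] with T hT
  rw [← intervalIntegral.integral_add_adjacent_intervals (hi δ c) (hi c T)]
  have h3 := (fdt hr hc0 hT hμ fun l hl => hφ l hl.1).trans h2
  calc _ ≤ _ := norm_add_le _ _
    _ ≤ 21 / A + 10 / A := add_le_add h1 h3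
    _ = _ := by ring

/-- Lemma 3.2 (oscillatory integral estimate): there exists `R₀ > 2` such that
for every `R > R₀` there is `C > 0`, depending only on `m_v, m_z, R₀, R`, such
that for every time function `t : (R₀,R) → (0, 1/ρ²)` and all distinct
`s, s' ∈ (R₀, R)`, the improper integral
`∫_{1/R₀}^∞ e^{i(λ(s'-s) + (t(s')-t(s))(λ²+ρ²))} (λ²+ρ²)^{-1/4} dλ`
converges and its modulus is at most `C(|s-s'|^{-1/2} + 1)`. -/
theorem oscillatory_integral_estimate (mv mz : ℕ) (hmv : 0 < mv) (hmz : 0 < mz) :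
    ∃ R₀ : ℝ, 2 < R₀ ∧ ∀ R : ℝ, R₀ < R → ∃ C : ℝ, 0 < C ∧
      ∀ t : ℝ → ℝ, (∀ s ∈ Set.Ioo R₀ R, t s ∈ Set.Ioo 0 (1 / rhoDR mv mz ^ 2)) →
      ∀ s ∈ Set.Ioo R₀ R, ∀ s' ∈ Set.Ioo R₀ R, s ≠ s' →
      ∃ L : ℂ,
        Filter.Tendsto
          (fun T : ℝ => ∫ l in Set.Ioc (1 / R₀) T,
            Complex.exp (Complex.I *
              ((l * (s' - s) + (t s' - t s) * (l ^ 2 + rhoDR mv mz ^ 2) : ℝ) : ℂ))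
              * (((l ^ 2 + rhoDR mv mz ^ 2) ^ (-(1 / 4) : ℝ) : ℝ) : ℂ))
          Filter.atTop (nhds L)
        ∧ ‖L‖ ≤ C * (|s - s'| ^ (-(1 / 2) : ℝ) + 1) := by
  have hr : 0 < rhoDR mv mz := by
    unfold rhoDR
    have : (0 : ℝ) < mv := by exact_mod_cast hmv
    positivity
  refine ⟨3, by norm_num, fun R _ => ⟨31, by norm_num, fun t _ s _ s' _ hss => ?_⟩⟩
  have ha : 0 < |s' - s| := abs_pos.2 (sub_ne_zero.2 hss.symm)
  obtain ⟨L, hL1, hL2⟩ := osc (a := s' - s) (b := t s' - t s) (δ := 1 / 3) hr (by norm_num)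
    (Real.sqrt_pos.2 ha) (Real.sq_sqrt ha.le).symm
  refine ⟨L, hL1, hL2.trans ?_⟩
  rw [abs_sub_comm s s', Real.rpow_neg ha.le, ← Real.sqrt_eq_rpow, div_eq_mul_inv]
  linarith
end

section
/- There exists R₀ > 2 such that for every R > R₀ there is a constant C > 0, depending only on m_v, m_z, R₀ and R, with the following property: for every measurable function t : (R₀, R) → (0, 1/ρ²) and every smooth function h : ℝ → ℂ compactly supported in (R₀, R), one has ∫_{1/R₀}^{∞} (λ²+ρ²)^{−1/4} | ∫_{R₀}^{R} A(s)^{−1/4} exp(−i[λ s + t(s)(λ²+ρ²)]) h(s) ds |² dλ ≤ C ( ∫_{R₀}^{R} |h(s)|^{4/3} ds )^{3/2}. -/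
open MeasureTheory Filter Set

noncomputable section

/-- The radial volume density of the Damek–Ricci space:
`A(s) = 2^{m_v+m_z} sinh(s/2)^{m_v+m_z} cosh(s/2)^{m_z}`. -/
def Adens (mv mz : ℕ) (s : ℝ) : ℝ :=
  2 ^ (mv + mz) * Real.sinh (s / 2) ^ (mv + mz) * Real.cosh (s / 2) ^ mz

end

open scoped ENNReal


noncomputable def osc_s1 (σ x τ l : ℝ) : ℂ :=
  (((l ^ 2 + σ) ^ (-(1 / 4) : ℝ) : ℝ) : ℂ) *
    Complex.exp (-(Complex.I * ((l * x + τ * (l ^ 2 + σ) : ℝ) : ℂ)))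

lemma osc_cont {σ : ℝ} (hσ : 0 < σ) (x τ : ℝ) : Continuous (osc_s1 σ x τ) := by
  unfold osc_s1
  refine Continuous.mul ?_ (by fun_prop)
  refine Complex.continuous_ofReal.comp ?_
  refine Continuous.rpow_const (by fun_prop) ?_
  intro l; left; positivity

lemma norm_e (y : ℝ) : ‖Complex.exp (-(Complex.I * (y : ℂ)))‖ = 1 := by
  rw [Complex.norm_exp]
  simp only [Complex.neg_re, Complex.mul_re, Complex.I_re, Complex.I_im, Complex.ofReal_re,
    Complex.ofReal_im]
  norm_num

lemma norm_osc {σ : ℝ} (hσ : 0 < σ) (x τ l : ℝ) :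
    ‖osc_s1 σ x τ l‖ = (l ^ 2 + σ) ^ (-(1 / 4) : ℝ) := by
  unfold osc_s1
  have : 0 ≤ (l ^ 2 + σ) ^ (-(1 / 4) : ℝ) := by positivity
  rw [norm_mul, Complex.norm_real, norm_e, mul_one, Real.norm_eq_abs, abs_of_nonneg this]

lemma wt_le {σ : ℝ} (hσ : 0 < σ) {l : ℝ} (hl : 0 < l) :
    (l ^ 2 + σ) ^ (-(1 / 4) : ℝ) ≤ l ^ (-(1 / 2) : ℝ) := by
  have h1 : l ^ (-(1 / 2) : ℝ) = (l ^ 2) ^ (-(1 / 4) : ℝ) := by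
    rw [← Real.rpow_natCast, ← Real.rpow_mul hl.le]; norm_num
  rw [h1]
  exact Real.rpow_le_rpow_of_nonpos (by positivity) (by linarith) (by norm_num)

lemma osc_conj (σ x τ l : ℝ) : osc_s1 σ (-x) (-τ) l = (starRingEnd ℂ) (osc_s1 σ x τ l) := by
  unfold osc_s1
  rw [map_mul, Complex.conj_ofReal, ← Complex.exp_conj]
  congr 2
  simp
  ring

lemma osc_int_conj (σ x τ p q : ℝ) :
    ‖∫ l in p..q, osc_s1 σ (-x) (-τ) l‖ = ‖∫ l in p..q, osc_s1 σ x τ l‖ := by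
  simp_rw [osc_conj]
  rw [intervalIntegral.intervalIntegral_conj, RCLike.norm_conj]

lemma wt_deriv {σ : ℝ} (hσ : 0 < σ) (l : ℝ) :
    HasDerivAt (fun l : ℝ => (l ^ 2 + σ) ^ (-(1 / 4) : ℝ))
      (-(1 / 2) * l * (l ^ 2 + σ) ^ (-(5 / 4) : ℝ)) l := by
  have h1 : HasDerivAt (fun l : ℝ => l ^ 2 + σ) (2 * l) l := by
    simpa using (hasDerivAt_pow 2 l).add_const σ
  have h2 := h1.rpow_const (p := -(1 / 4)) (Or.inl (by positivity))
  refine h2.congr_deriv ?_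
  rw [show (-(1 / 4) - 1 : ℝ) = -(5 / 4) by norm_num]
  ring

lemma vdc {σ : ℝ} (hσ : 0 < σ) (x τ m p q : ℝ) (hm : 0 < m) (hp : 0 < p) (hpq : p ≤ q)
    (hφ : ∀ l ∈ Icc p q, m ≤ x + 2 * τ * l) :
    ‖∫ l in p..q, osc_s1 σ x τ l‖ ≤ 4 * p ^ (-(1 / 2) : ℝ) / m := by
  set w : ℝ → ℝ := fun l => (l ^ 2 + σ) ^ (-(1 / 4) : ℝ) with hw
  set w' : ℝ → ℝ := fun l => -(1 / 2) * l * (l ^ 2 + σ) ^ (-(5 / 4) : ℝ) with hw'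
  have hwd : ∀ l, HasDerivAt w (w' l) l := wt_deriv hσ
  have hw0 : ∀ l, 0 ≤ w l := fun l => by simp only [hw]; positivity
  have hw'c : Continuous w' := by
    simp only [hw']
    refine Continuous.mul (by fun_prop) ?_
    exact Continuous.rpow_const (by fun_prop) (fun l => Or.inl (by positivity))
  have hw'0 : ∀ l ∈ Icc p q, w' l ≤ 0 := by
    intro l hl
    have h0 : 0 < l := lt_of_lt_of_le hp hl.1
    have : 0 ≤ (1 / 2) * l * (l ^ 2 + σ) ^ (-(5 / 4) : ℝ) := by positivity
    simp only [hw']; linarith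
  have hwp : ∀ l ∈ Icc p q, w l ≤ w p := by
    intro l hl
    simp only [hw]
    refine Real.rpow_le_rpow_of_nonpos (by positivity) ?_ (by norm_num)
    have := hl.1
    nlinarith
  have hpos : ∀ l ∈ Icc p q, 0 < x + 2 * τ * l := fun l hl => lt_of_lt_of_le hm (hφ l hl)
  have hφd : ∀ l, HasDerivAt (fun l : ℝ => x + 2 * τ * l) (2 * τ) l := by
    intro l
    simpa using ((hasDerivAt_id l).const_mul (2 * τ)).const_add x
  set e : ℝ → ℂ := fun l => Complex.exp (-(Complex.I * ((l * x + τ * (l ^ 2 + σ) : ℝ) : ℂ))) with he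
  have hen : ∀ l, ‖e l‖ = 1 := by
    intro l; exact norm_e _
  have hed : ∀ l, HasDerivAt e (e l * (-(Complex.I * ((x + 2 * τ * l : ℝ) : ℂ)))) l := by
    intro l
    have h1 : HasDerivAt (fun l : ℝ => l * x + τ * (l ^ 2 + σ)) (x + 2 * τ * l) l := by
      have := ((hasDerivAt_id l).mul_const x).add (((hasDerivAt_pow 2 l).add_const σ).const_mul τ)
      refine this.congr_deriv ?_
      simp only [Nat.cast_ofNat]
      ring
    exact ((h1.ofReal_comp.const_mul Complex.I).neg).cexp
  set v : ℝ → ℝ := fun l => w l / (x + 2 * τ * l) with hv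
  set v' : ℝ → ℝ := fun l => (w' l * (x + 2 * τ * l) - w l * (2 * τ)) / (x + 2 * τ * l) ^ 2 with hv'
  have hvd : ∀ l ∈ Icc p q, HasDerivAt v (v' l) l := fun l hl =>
    (hwd l).div (hφd l) (hpos l hl).ne'
  have hwc : Continuous w := continuous_iff_continuousAt.2 fun l => (hwd l).continuousAt
  have hec : Continuous e := continuous_iff_continuousAt.2 fun l => (hed l).continuousAt
  have hv'c : ContinuousOn v' (Icc p q) := by
    simp only [hv']
    refine ContinuousOn.div (by fun_prop) (by fun_prop) ?_
    intro l hl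
    exact pow_ne_zero _ (hpos l hl).ne'
  have hu : uIcc p q = Icc p q := uIcc_of_le hpq
  have hprod : ∀ l ∈ uIcc p q, HasDerivAt (fun l => Complex.I * ((v l : ℂ) * e l))
      (Complex.I * ((v' l : ℂ) * e l) + osc_s1 σ x τ l) l := by
    intro l hl
    rw [hu] at hl
    have := (((hvd l hl).ofReal_comp).mul (hed l)).const_mul Complex.I
    refine this.congr_deriv ?_
    have h2 : osc_s1 σ x τ l = (w l : ℂ) * e l := rfl
    rw [h2]
    have h3 : (w l : ℂ) = (v l : ℂ) * ((x + 2 * τ * l : ℝ) : ℂ) := by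
      rw [← Complex.ofReal_mul]
      congr 1
      simp only [hv]
      rw [div_mul_cancel₀ _ (hpos l hl).ne']
    rw [h3]
    linear_combination (-(v l : ℂ) * ((x + 2 * τ * l : ℝ) : ℂ) * e l) * Complex.I_mul_I
  have hI1 : IntervalIntegrable (fun l => Complex.I * ((v' l : ℂ) * e l)) volume p q := by
    apply ContinuousOn.intervalIntegrable
    rw [hu]
    exact continuousOn_const.mul ((Complex.continuous_ofReal.comp_continuousOn hv'c).mul hec.continuousOn)
  have hI2 : IntervalIntegrable (osc_s1 σ x τ) volume p q := (osc_cont hσ x τ).intervalIntegrable _ _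
  have hftc := intervalIntegral.integral_eq_sub_of_hasDerivAt hprod (hI1.add hI2)
  rw [intervalIntegral.integral_add hI1 hI2] at hftc
  obtain ⟨s, hs1, hs2⟩ : ∃ s : ℝ, |s| = 1 ∧ s * τ = |τ| := by
    rcases le_total 0 τ with h | h
    · exact ⟨1, by simp, by rw [abs_of_nonneg h]; ring⟩
    · exact ⟨-1, by simp, by rw [abs_of_nonpos h]; ring⟩
  set H' : ℝ → ℝ := fun l => -w' l / m + w p * s * (2 * τ) / (x + 2 * τ * l) ^ 2 with hH'
  have hHd : ∀ l ∈ uIcc p q, HasDerivAt (fun l => -w l / m - w p * s / (x + 2 * τ * l)) (H' l) l := by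
    intro l hl
    rw [hu] at hl
    have h1 := ((hwd l).neg.div_const m).sub
      ((hasDerivAt_const l (w p * s)).div (hφd l) (hpos l hl).ne')
    refine h1.congr_deriv ?_
    simp only [hH']
    ring
  have hH'i : IntervalIntegrable H' volume p q := by
    apply ContinuousOn.intervalIntegrable
    rw [hu]
    simp only [hH']
    refine ContinuousOn.add (by fun_prop) (ContinuousOn.div (by fun_prop) (by fun_prop) ?_)
    intro l hl
    exact pow_ne_zero _ (hpos l hl).ne'
  have hHI := intervalIntegral.integral_eq_sub_of_hasDerivAt hHd hH'i
  have hbd : ‖∫ l in p..q, Complex.I * ((v' l : ℂ) * e l)‖ ≤ ∫ l in p..q, H' l := by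
    refine intervalIntegral.norm_integral_le_of_norm_le hpq ?_ hH'i
    refine Eventually.of_forall fun l hl => ?_
    have hl : l ∈ Icc p q := Ioc_subset_Icc_self hl
    rw [norm_mul, norm_mul, hen, Complex.norm_I, one_mul, mul_one, Complex.norm_real, Real.norm_eq_abs]
    have hP := hpos l hl
    have e1 : v' l = w' l / (x + 2 * τ * l) - w l * (2 * τ) / (x + 2 * τ * l) ^ 2 := by
      simp only [hv']; field_simp
    rw [e1]
    refine (abs_sub _ _).trans ?_
    simp only [hH']
    refine add_le_add ?_ ?_
    · rw [abs_div, abs_of_nonpos (hw'0 l hl), abs_of_pos hP]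
      exact div_le_div_of_nonneg_left (by linarith [hw'0 l hl]) hm (hφ l hl)
    · rw [abs_div, abs_of_pos (pow_pos hP 2)]
      gcongr
      rw [abs_mul, abs_of_nonneg (hw0 l), abs_mul, abs_two]
      have : w p * s * (2 * τ) = w p * (2 * |τ|) := by rw [← hs2]; ring
      rw [this]
      gcongr
      exact hwp l hl
  rw [hHI] at hbd
  have hpI : p ∈ Icc p q := ⟨le_rfl, hpq⟩
  have hqI : q ∈ Icc p q := ⟨hpq, le_rfl⟩
  have hwple : w p ≤ p ^ (-(1 / 2) : ℝ) := wt_le hσ hp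
  have b1 : ∀ l ∈ Icc p q, v l ≤ w p / m := by
    intro l hl
    simp only [hv]
    exact div_le_div₀ (hw0 p) (hwp l hl) hm (hφ l hl)
  have b0 : ∀ l ∈ Icc p q, 0 ≤ v l := fun l hl => div_nonneg (hw0 l) (hpos l hl).le
  have nb : ∀ l ∈ Icc p q, ‖Complex.I * ((v l : ℂ) * e l)‖ ≤ w p / m := by
    intro l hl
    rw [norm_mul, norm_mul, hen, Complex.norm_I, one_mul, mul_one, Complex.norm_real, Real.norm_eq_abs,
      abs_of_nonneg (b0 l hl)]
    exact b1 l hl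
  have c1 : ∀ l ∈ Icc p q, w p / (x + 2 * τ * l) ≤ w p / m := fun l hl =>
    div_le_div_of_nonneg_left (hw0 p) hm (hφ l hl)
  have c0 : ∀ l ∈ Icc p q, 0 ≤ w p / (x + 2 * τ * l) := fun l hl =>
    div_nonneg (hw0 p) (hpos l hl).le
  have hH : -w q / m - w p * s / (x + 2 * τ * q) - (-w p / m - w p * s / (x + 2 * τ * p))
      ≤ 2 * (w p / m) := by
    have k1 : w p * s / (x + 2 * τ * q) = s * (w p / (x + 2 * τ * q)) := by ring
    have k2 : w p * s / (x + 2 * τ * p) = s * (w p / (x + 2 * τ * p)) := by ring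
    have k3 : 0 ≤ w q / m := div_nonneg (hw0 q) hm.le
    rw [k1, k2, neg_div, neg_div]
    have := c1 p hpI; have := c1 q hqI; have := c0 p hpI; have := c0 q hqI
    rcases (abs_eq (by norm_num : (0 : ℝ) ≤ 1)).1 hs1 with h | h <;> rw [h] <;> linarith
  have hG : ∫ l in p..q, osc_s1 σ x τ l = Complex.I * ((v q : ℂ) * e q) - Complex.I * ((v p : ℂ) * e p)
      - ∫ l in p..q, Complex.I * ((v' l : ℂ) * e l) := by
    rw [← hftc]; ring
  rw [hG]
  calc _ ≤ ‖Complex.I * ((v q : ℂ) * e q)‖ + ‖Complex.I * ((v p : ℂ) * e p)‖ +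
        ‖∫ l in p..q, Complex.I * ((v' l : ℂ) * e l)‖ :=
        (norm_sub_le _ _).trans (add_le_add_left (norm_sub_le _ _) _)
    _ ≤ w p / m + w p / m + 2 * (w p / m) := by
        gcongr
        · exact nb q hqI
        · exact nb p hpI
        · exact hbd.trans hH
    _ = 4 * w p / m := by ring
    _ ≤ _ := by gcongr

lemma vdc_neg {σ : ℝ} (hσ : 0 < σ) (x τ m p q : ℝ) (hm : 0 < m) (hp : 0 < p) (hpq : p ≤ q)
    (hφ : ∀ l ∈ Icc p q, m ≤ -(x + 2 * τ * l)) :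
    ‖∫ l in p..q, osc_s1 σ x τ l‖ ≤ 4 * p ^ (-(1 / 2) : ℝ) / m := by
  rw [← osc_int_conj]
  refine vdc hσ _ _ m p q hm hp hpq fun l hl => ?_
  have := hφ l hl
  linarith

lemma osc_triv {σ : ℝ} (hσ : 0 < σ) (x τ p q : ℝ) (hp : 0 < p) (hpq : p ≤ q) :
    ‖∫ l in p..q, osc_s1 σ x τ l‖ ≤ p ^ (-(1 / 2) : ℝ) * (q - p) := by
  have := intervalIntegral.norm_integral_le_of_norm_le_const (a := p) (b := q)
    (f := osc_s1 σ x τ) (C := p ^ (-(1 / 2) : ℝ)) ?_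
  · rwa [abs_of_nonneg (by linarith)] at this
  · intro l hl
    rw [uIoc_of_le hpq] at hl
    rw [norm_osc hσ]
    have hl0 : 0 < l := hp.trans hl.1
    exact (wt_le hσ hl0).trans (Real.rpow_le_rpow_of_nonpos hp hl.1.le (by norm_num))

lemma osc_low {σ : ℝ} (hσ : 0 < σ) (x τ p q : ℝ) (hp : 0 < p) (hpq : p ≤ q) :
    ‖∫ l in p..q, osc_s1 σ x τ l‖ ≤ 2 * q ^ ((1 / 2) : ℝ) := by
  have hi : IntervalIntegrable (fun l : ℝ => l ^ (-(1 / 2) : ℝ)) volume p q :=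
    intervalIntegral.intervalIntegrable_rpow' (by norm_num)
  have := intervalIntegral.norm_integral_le_of_norm_le hpq (f := osc_s1 σ x τ) (μ := volume)
    (g := fun l : ℝ => l ^ (-(1 / 2) : ℝ)) ?_ hi
  · refine this.trans ?_
    rw [integral_rpow (Or.inl (by norm_num))]
    have h1 : 0 ≤ p ^ ((1 / 2) : ℝ) := by positivity
    rw [show (-(1 / 2) + 1 : ℝ) = 1 / 2 by norm_num]
    linarith
  · refine Eventually.of_forall fun l hl => ?_
    rw [norm_osc hσ]
    exact wt_le hσ (hp.trans hl.1)

lemma ker_high {σ : ℝ} (hσ : 0 < σ) (x τ a N : ℝ) (hx : 0 < x) (ha : 1 / x ≤ a) (haN : a ≤ N) :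
    ‖∫ l in a..N, osc_s1 σ x τ l‖ ≤ 24 * x ^ (-(1 / 2) : ℝ) := by
  set X := x ^ (-(1 / 2) : ℝ) with hX
  have hX0 : 0 < X := by positivity
  have ha0 : 0 < a := lt_of_lt_of_le (by positivity) ha
  have hpx : ∀ p, a ≤ p → p ^ (-(1 / 2) : ℝ) ≤ x * X := by
    intro p hp
    have h1 : p ^ (-(1 / 2) : ℝ) ≤ (1 / x) ^ (-(1 / 2) : ℝ) :=
      Real.rpow_le_rpow_of_nonpos (by positivity) (ha.trans hp) (by norm_num)
    have h2 : (1 / x) ^ (-(1 / 2) : ℝ) = x * X := by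
      rw [hX, one_div, Real.inv_rpow hx.le, ← Real.rpow_neg hx.le]
      nth_rewrite 2 [← Real.rpow_one x]
      rw [← Real.rpow_add hx]; norm_num
    linarith
  rcases le_or_gt 0 τ with hτ | hτ
  · have := vdc hσ x τ x a N hx ha0 haN (fun l hl => by
      have : 0 ≤ l := ha0.le.trans hl.1
      nlinarith [mul_nonneg hτ this])
    refine this.trans ?_
    rw [div_le_iff₀ hx]
    nlinarith [hpx a le_rfl, mul_pos hX0 hx]
  set S := Real.sqrt (-τ) with hS
  have hS0 : 0 < S := Real.sqrt_pos.2 (by linarith)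
  have hSS : τ = -(S ^ 2) := by
    rw [hS, Real.sq_sqrt (by linarith)]; ring
  clear_value S
  subst hSS
  set L := x / (2 * S ^ 2) with hL
  have hL0 : 0 < L := by positivity
  have hxL : x = 2 * S ^ 2 * L := by rw [hL]; field_simp
  have hpL : ∀ p, L / 2 ≤ p → p ^ (-(1 / 2) : ℝ) ≤ 2 * S * X := by
    intro p hp
    have h1 : p ^ (-(1 / 2) : ℝ) ≤ (L / 2) ^ (-(1 / 2) : ℝ) :=
      Real.rpow_le_rpow_of_nonpos (by positivity) hp (by norm_num)
    have h2 : (L / 2) ^ (-(1 / 2) : ℝ) = 2 * S * X := by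
      have e1 : L / 2 = x * ((2 * S) ^ 2)⁻¹ := by rw [hL]; field_simp
      rw [e1, Real.mul_rpow hx.le (by positivity), Real.inv_rpow (by positivity),
        ← Real.rpow_neg (by positivity), neg_neg, ← Real.sqrt_eq_rpow,
        Real.sqrt_sq (by positivity)]
      ring
    linarith
  set cl : ℝ → ℝ := fun b => max a (min N b) with hcl
  have clm : ∀ b b', b ≤ b' → cl b ≤ cl b' := by
    intro b b' h; simp only [hcl]; gcongr
  have piece : ∀ b b' K : ℝ, b ≤ b' → 0 ≤ K →
      (∀ p q, a ≤ p → q ≤ N → b ≤ p → q ≤ b' → p < q → ‖∫ l in p..q, osc_s1 σ x (-(S ^ 2)) l‖ ≤ K) →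
      ‖∫ l in cl b..cl b', osc_s1 σ x (-(S ^ 2)) l‖ ≤ K := by
    intro b b' K hb hK h
    rcases (clm b b' hb).eq_or_lt with h1 | h1
    · rw [h1]; simpa using hK
    · have h3 : cl b' ≤ N := max_le haN (min_le_left _ _)
      refine h _ _ (le_max_left _ _) h3 ?_ ?_ h1
      · by_contra hc
        push Not at hc
        have : min N b < b := lt_of_le_of_lt (le_max_right _ _) hc
        have h4 : min N b = N := by
          rcases min_choice N b with h | h
          · exact h
          · exact absurd h this.ne
        have : N ≤ cl b := by rw [← h4]; exact le_max_right _ _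
        linarith
      · have h2 : a < cl b' := lt_of_le_of_lt (le_max_left _ _) h1
        have h4 : cl b' = min N b' := by
          rcases max_choice a (min N b') with h | h
          · exact absurd h h2.ne'
          · exact h
        rw [h4]; exact min_le_right _ _
  set d := 1 / S with hd
  have hd0 : 0 < d := by positivity
  have hSd : S * d = 1 := by rw [hd]; field_simp
  set b1 := L / 2
  set b2 := max (L / 2) (L - d)
  set b3 := min (2 * L) (L + d)
  have h12 : b1 ≤ b2 := le_max_left _ _
  have h23 : b2 ≤ b3 := max_le (le_min (by linarith) (by linarith)) (le_min (by linarith) (by linarith))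
  have h34 : b3 ≤ 2 * L := min_le_left _ _
  have hXx : x * X > 0 := by positivity
  have hii : ∀ p q, IntervalIntegrable (osc_s1 σ x (-(S ^ 2))) volume p q := fun p q =>
    (osc_cont hσ _ _).intervalIntegrable _ _
  -- piece 1
  have p1 : ‖∫ l in cl (min a b1)..cl b1, osc_s1 σ x (-(S ^ 2)) l‖ ≤ 8 * X := by
    refine piece _ _ _ (min_le_right _ _) (by positivity) fun p q hap hqN hbp hqb hpq => ?_
    have := vdc hσ x (-(S ^ 2)) (x / 2) p q (by positivity) (by linarith) hpq.le (fun l hl => by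
      have h1 : l ≤ L / 2 := hl.2.trans hqb
      have : S ^ 2 * l ≤ S ^ 2 * (L / 2) := by gcongr
      nlinarith)
    refine this.trans ?_
    rw [div_le_iff₀ (by positivity)]
    nlinarith [hpx p hap]
  have p2 : ‖∫ l in cl b1..cl b2, osc_s1 σ x (-(S ^ 2)) l‖ ≤ 4 * X := by
    refine piece _ _ _ h12 (by positivity) fun p q hap hqN hbp hqb hpq => ?_
    have hq : q ≤ L - d := by
      rcases le_max_iff.1 hqb with h | h
      · exact absurd (hbp.trans_lt hpq) (not_lt.2 h)
      · exact h
    have := vdc hσ x (-(S ^ 2)) (2 * S) p q (by positivity) (by linarith) hpq.le (fun l hl => by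
      have h1 : l ≤ L - d := hl.2.trans hq
      have : S ^ 2 * l ≤ S ^ 2 * (L - d) := by gcongr
      have h2 : S ^ 2 * d = S := by rw [pow_two, mul_assoc, hSd, mul_one]
      nlinarith)
    refine this.trans ?_
    rw [div_le_iff₀ (by positivity)]
    nlinarith [hpL p hbp]
  have p3 : ‖∫ l in cl b2..cl b3, osc_s1 σ x (-(S ^ 2)) l‖ ≤ 4 * X := by
    refine piece _ _ _ h23 (by positivity) fun p q hap hqN hbp hqb hpq => ?_
    have hq : q ≤ L + d := hqb.trans (min_le_right _ _)
    have hp : L - d ≤ p := (le_max_right _ _).trans hbp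
    refine (osc_triv hσ x _ p q (by linarith) hpq.le).trans ?_
    calc p ^ (-(1 / 2) : ℝ) * (q - p) ≤ 2 * S * X * (2 * d) := by
          gcongr
          · exact hpL p (h12.trans hbp)
          · linarith
      _ = 4 * X * (S * d) := by ring
      _ = 4 * X := by rw [hSd, mul_one]
  have p4 : ‖∫ l in cl b3..cl (2 * L), osc_s1 σ x (-(S ^ 2)) l‖ ≤ 4 * X := by
    refine piece _ _ _ h34 (by positivity) fun p q hap hqN hbp hqb hpq => ?_
    have hp : L + d ≤ p := by
      rcases min_le_iff.1 hbp with h | h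
      · exact absurd (h.trans_lt hpq) (not_lt.2 hqb)
      · exact h
    have := vdc_neg hσ x (-(S ^ 2)) (2 * S) p q (by positivity) (by linarith) hpq.le (fun l hl => by
      have h1 : L + d ≤ l := hp.trans hl.1
      have : S ^ 2 * (L + d) ≤ S ^ 2 * l := by gcongr
      have h2 : S ^ 2 * d = S := by rw [pow_two, mul_assoc, hSd, mul_one]
      nlinarith)
    refine this.trans ?_
    rw [div_le_iff₀ (by positivity)]
    nlinarith [hpL p (by linarith)]
  have p5 : ‖∫ l in cl (2 * L)..cl (max N (2 * L)), osc_s1 σ x (-(S ^ 2)) l‖ ≤ 4 * X := by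
    refine piece _ _ _ (le_max_right _ _) (by positivity) fun p q hap hqN hbp hqb hpq => ?_
    have := vdc_neg hσ x (-(S ^ 2)) x p q (by positivity) (by linarith) hpq.le (fun l hl => by
      have h1 : 2 * L ≤ l := hbp.trans hl.1
      have : S ^ 2 * (2 * L) ≤ S ^ 2 * l := by gcongr
      nlinarith)
    refine this.trans ?_
    rw [div_le_iff₀ (by positivity)]
    nlinarith [hpx p hap]
  have ea : cl (min a b1) = a := max_eq_left ((min_le_right _ _).trans (min_le_left _ _))
  have eN : cl (max N (2 * L)) = N := by
    simp only [hcl]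
    rw [min_eq_left (le_max_left _ _), max_eq_right haN]
  rw [ea] at p1
  rw [eN] at p5
  rw [← intervalIntegral.integral_add_adjacent_intervals (hii a (cl (2 * L))) (hii _ N),
    ← intervalIntegral.integral_add_adjacent_intervals (hii a (cl b3)) (hii _ (cl (2 * L))),
    ← intervalIntegral.integral_add_adjacent_intervals (hii a (cl b2)) (hii _ (cl b3)),
    ← intervalIntegral.integral_add_adjacent_intervals (hii a (cl b1)) (hii _ (cl b2))]
  refine (norm_add_le _ _).trans ?_
  have q1 := norm_add_le (∫ l in a..cl b1, osc_s1 σ x (-(S ^ 2)) l) (∫ l in cl b1..cl b2, osc_s1 σ x (-(S ^ 2)) l)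
  have q2 := norm_add_le ((∫ l in a..cl b1, osc_s1 σ x (-(S ^ 2)) l) + ∫ l in cl b1..cl b2, osc_s1 σ x (-(S ^ 2)) l)
    (∫ l in cl b2..cl b3, osc_s1 σ x (-(S ^ 2)) l)
  have q3 := norm_add_le (((∫ l in a..cl b1, osc_s1 σ x (-(S ^ 2)) l) + ∫ l in cl b1..cl b2, osc_s1 σ x (-(S ^ 2)) l)
    + ∫ l in cl b2..cl b3, osc_s1 σ x (-(S ^ 2)) l) (∫ l in cl b3..cl (2 * L), osc_s1 σ x (-(S ^ 2)) l)
  linarith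

lemma ker_pos {σ : ℝ} (hσ : 0 < σ) (x τ a N : ℝ) (hx : 0 < x) (ha : 0 < a) (haN : a ≤ N) :
    ‖∫ l in a..N, osc_s1 σ x τ l‖ ≤ 26 * x ^ (-(1 / 2) : ℝ) := by
  have hX0 : 0 < x ^ (-(1 / 2) : ℝ) := by positivity
  have low : ∀ q, a ≤ q → q ≤ 1 / x → ‖∫ l in a..q, osc_s1 σ x τ l‖ ≤ 2 * x ^ (-(1 / 2) : ℝ) := by
    intro q hq hqx
    refine (osc_low hσ x τ a q ha hq).trans ?_
    have h1 : q ^ (1 / 2 : ℝ) ≤ (1 / x) ^ (1 / 2 : ℝ) :=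
      Real.rpow_le_rpow (by linarith) hqx (by norm_num)
    rw [one_div x, Real.inv_rpow hx.le, ← Real.rpow_neg hx.le] at h1
    linarith
  rcases le_total N (1 / x) with h | h
  · linarith [low N haN h]
  rcases le_total (1 / x) a with h' | h'
  · linarith [ker_high hσ x τ a N hx h' haN]
  · have hii : ∀ p q, IntervalIntegrable (osc_s1 σ x τ) volume p q := fun p q =>
      (osc_cont hσ _ _).intervalIntegrable _ _
    rw [← intervalIntegral.integral_add_adjacent_intervals (hii a (1 / x)) (hii _ N)]
    refine (norm_add_le _ _).trans ?_
    linarith [low (1 / x) h' le_rfl, ker_high hσ x τ (1 / x) N hx le_rfl h]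

lemma ker_bound {σ : ℝ} (hσ : 0 < σ) (x τ a N : ℝ) (hx : x ≠ 0) (ha : 0 < a) (haN : a ≤ N) :
    ‖∫ l in a..N, osc_s1 σ x τ l‖ ≤ 26 * |x| ^ (-(1 / 2) : ℝ) := by
  rcases lt_or_gt_of_ne hx with h | h
  · rw [abs_of_neg h, ← osc_int_conj]
    exact ker_pos hσ _ _ a N (by linarith) ha haN
  · rw [abs_of_pos h]
    exact ker_pos hσ _ _ a N h ha haN

lemma lint_abs (G : ℝ → ℝ≥0∞) (hG : Measurable G) :
    ∫⁻ u, G |u| = 2 * ∫⁻ u in Ioi (0 : ℝ), G u := by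
  rw [← lintegral_add_compl (fun u => G |u|) (measurableSet_Ioi (a := (0 : ℝ))), two_mul]
  have h1 : ∫⁻ u in Ioi (0 : ℝ), G |u| = ∫⁻ u in Ioi (0 : ℝ), G u :=
    setLIntegral_congr_fun measurableSet_Ioi fun u hu => by rw [abs_of_pos hu]
  have h2 : ∫⁻ u in (Ioi (0 : ℝ))ᶜ, G |u| = ∫⁻ u in Ioi (0 : ℝ), G u := by
    rw [compl_Ioi, setLIntegral_congr Iio_ae_eq_Iic.symm]
    have := (Measure.measurePreserving_neg (volume : Measure ℝ)).setLIntegral_comp_preimage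
      (s := Ioi (0 : ℝ)) measurableSet_Ioi hG
    rw [← this]
    have hs : Neg.neg ⁻¹' Ioi (0 : ℝ) = Iio 0 := by ext; simp
    rw [hs]
    exact setLIntegral_congr_fun measurableSet_Iio fun u hu => by rw [abs_of_neg hu]
  rw [h1, h2]

noncomputable def kk (u : ℝ) : ℝ≥0∞ := (ENNReal.ofReal |u|) ^ (-(1 / 2) : ℝ)

lemma kk_meas : Measurable kk := by unfold kk; fun_prop

lemma kk_ne {u : ℝ} (hu : u ≠ 0) : kk u = ENNReal.ofReal (|u| ^ (-(1 / 2) : ℝ)) := by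
  unfold kk
  rw [ENNReal.ofReal_rpow_of_pos (abs_pos.2 hu)]

lemma kk_int {r : ℝ} (hr : 0 < r) :
    ∫⁻ u, (Iic r).indicator (fun u => ENNReal.ofReal (u ^ (-(1 / 2) : ℝ))) |u|
      ≤ ENNReal.ofReal (4 * r ^ (1 / 2 : ℝ)) := by
  rw [lint_abs _ (Measurable.indicator (by fun_prop) measurableSet_Iic),
    lintegral_indicator measurableSet_Iic, Measure.restrict_restrict measurableSet_Iic,
    inter_comm, Ioi_inter_Iic]
  have hi : IntervalIntegrable (fun l : ℝ => l ^ (-(1 / 2) : ℝ)) volume 0 r :=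
    intervalIntegral.intervalIntegrable_rpow' (by norm_num)
  have hi2 := (intervalIntegrable_iff_integrableOn_Ioc_of_le hr.le).1 hi
  rw [← ofReal_integral_eq_lintegral_ofReal hi2 ?_,
    ← intervalIntegral.integral_of_le hr.le, integral_rpow (Or.inl (by norm_num))]
  · rw [show (2 : ℝ≥0∞) = ENNReal.ofReal 2 by simp, ← ENNReal.ofReal_mul (by norm_num)]
    apply ENNReal.ofReal_le_ofReal
    rw [show (-(1 / 2) + 1 : ℝ) = 1 / 2 by norm_num, Real.zero_rpow (by norm_num)]
    linarith
  · exact (ae_restrict_iff' measurableSet_Ioc).2 (Eventually.of_forall fun u hu =>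
      Real.rpow_nonneg hu.1.le _)

lemma tail_int {r : ℝ} (hr : 0 < r) :
    ∫⁻ u, (Ioi r).indicator (fun u => ENNReal.ofReal (u ^ (-2 : ℝ))) |u|
      ≤ ENNReal.ofReal (2 / r) := by
  rw [lint_abs _ (Measurable.indicator (by fun_prop) measurableSet_Ioi),
    lintegral_indicator measurableSet_Ioi, Measure.restrict_restrict measurableSet_Ioi,
    Ioi_inter_Ioi, max_eq_left hr.le]
  have hi2 : IntegrableOn (fun l : ℝ => l ^ (-2 : ℝ)) (Ioi r) :=
    integrableOn_Ioi_rpow_of_lt (by norm_num) hr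
  rw [← ofReal_integral_eq_lintegral_ofReal hi2 ?_, integral_Ioi_rpow_of_lt (by norm_num) hr]
  · rw [show (2 : ℝ≥0∞) = ENNReal.ofReal 2 by simp, ← ENNReal.ofReal_mul (by norm_num)]
    apply ENNReal.ofReal_le_ofReal
    rw [show (-2 + 1 : ℝ) = -1 by norm_num, Real.rpow_neg_one]
    apply le_of_eq; field_simp
  · exact (ae_restrict_iff' measurableSet_Ioi).2 (Eventually.of_forall fun u hu =>
      Real.rpow_nonneg (hr.trans hu).le _)

lemma young_ptw {f c U : ℝ} (hf : 0 ≤ f) (hc : 0 < c) (hU : 0 < U) :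
    f * U ^ (-(1 / 2) : ℝ) ≤ c * f ^ (4 / 3 : ℝ) + (c ^ 3)⁻¹ * U ^ (-2 : ℝ) := by
  set φ := f ^ (1 / 3 : ℝ) with hφ
  set q := U ^ (-(1 / 2) : ℝ) with hq
  have hφ0 : 0 ≤ φ := by positivity
  have hq0 : 0 < q := by positivity
  have e1 : f = φ ^ 3 := by rw [hφ, ← Real.rpow_natCast, ← Real.rpow_mul hf]; norm_num
  have e2 : f ^ (4 / 3 : ℝ) = φ ^ 4 := by rw [hφ, ← Real.rpow_natCast, ← Real.rpow_mul hf]; norm_num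
  have e3 : U ^ (-2 : ℝ) = q ^ 4 := by rw [hq, ← Real.rpow_natCast, ← Real.rpow_mul hU.le]; norm_num
  rw [e2, e3, e1]
  rcases le_total q (c * φ) with h | h
  · have h1 : φ ^ 3 * q ≤ φ ^ 3 * (c * φ) := by gcongr
    have : 0 ≤ (c ^ 3)⁻¹ * q ^ 4 := by positivity
    nlinarith
  · have h1 : (c * φ) ^ 3 ≤ q ^ 3 := by gcongr
    have h2 : φ ^ 3 ≤ (c ^ 3)⁻¹ * q ^ 3 := by
      rw [inv_mul_eq_div, le_div_iff₀ (by positivity)]; nlinarith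
    have h3 : φ ^ 3 * q ≤ (c ^ 3)⁻¹ * q ^ 3 * q := by gcongr
    have : 0 ≤ c * φ ^ 4 := by positivity
    nlinarith

lemma hls_inner (f : ℝ → ℝ) (hf : Measurable f) (h0 : ∀ x, 0 ≤ f x) (b : ℝ) (hb : 0 < b)
    (hB : ∫⁻ y, ENNReal.ofReal (f y ^ (4 / 3 : ℝ)) = ENNReal.ofReal b) (v x : ℝ) (hv : 0 < v) :
    ∫⁻ y, {y | f y ≤ v}.indicator (fun y => ENNReal.ofReal (f y) * kk (x - y)) y
      ≤ ENNReal.ofReal (7 * v ^ (1 / 3 : ℝ) * b ^ (1 / 2 : ℝ)) := by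
  set φ := v ^ (1 / 3 : ℝ) with hφ
  set β := b ^ (1 / 2 : ℝ) with hβ
  have hφ0 : 0 < φ := by positivity
  have hβ0 : 0 < β := by positivity
  have ev : v = φ ^ 3 := by rw [hφ, ← Real.rpow_natCast, ← Real.rpow_mul hv.le]; norm_num
  have eb : b = β ^ 2 := by rw [hβ, ← Real.rpow_natCast, ← Real.rpow_mul hb.le]; norm_num
  set r := (β / φ ^ 2) ^ 2 with hr
  have hr0 : 0 < r := by positivity
  have er : r ^ (1 / 2 : ℝ) = β / φ ^ 2 := by
    rw [← Real.sqrt_eq_rpow, hr, Real.sqrt_sq (by positivity)]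
  set c := φ / β with hc
  have hc0 : 0 < c := by positivity
  set G1 : ℝ → ℝ≥0∞ := (Iic r).indicator (fun u => ENNReal.ofReal (u ^ (-(1 / 2) : ℝ))) with hG1
  set G2 : ℝ → ℝ≥0∞ := (Ioi r).indicator (fun u => ENNReal.ofReal (u ^ (-2 : ℝ))) with hG2
  have mG1 : Measurable (fun u : ℝ => G1 |u|) :=
    (Measurable.indicator (by fun_prop) measurableSet_Iic).comp measurable_norm
  have mG2 : Measurable (fun u : ℝ => G2 |u|) :=
    (Measurable.indicator (by fun_prop) measurableSet_Ioi).comp measurable_norm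
  have mp := Measure.measurePreserving_sub_left (volume : Measure ℝ) x
  have i1 : ∫⁻ y, G1 |x - y| ≤ ENNReal.ofReal (4 * r ^ (1 / 2 : ℝ)) := by
    rw [mp.lintegral_comp mG1]; exact kk_int hr0
  have i2 : ∫⁻ y, G2 |x - y| ≤ ENNReal.ofReal (2 / r) := by
    rw [mp.lintegral_comp mG2]; exact tail_int hr0
  have mG1' : Measurable (fun y : ℝ => G1 |x - y|) := mG1.comp mp.measurable
  have mG2' : Measurable (fun y : ℝ => G2 |x - y|) := mG2.comp mp.measurable
  calc _ ≤ ∫⁻ y, (ENNReal.ofReal v * G1 |x - y| +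
        (ENNReal.ofReal c * ENNReal.ofReal (f y ^ (4 / 3 : ℝ)) +
          ENNReal.ofReal ((c ^ 3)⁻¹) * G2 |x - y|)) := by
        refine lintegral_mono_ae ?_
        filter_upwards [(Measure.ae_ne volume x : ∀ᵐ y ∂(volume : Measure ℝ), y ≠ x)] with y hy
        have hu : x - y ≠ 0 := sub_ne_zero.2 hy.symm
        by_cases hfy : f y ≤ v
        · rw [indicator_of_mem (show y ∈ {y | f y ≤ v} from hfy), kk_ne hu]
          rcases le_or_gt |x - y| r with h | h
          · refine le_trans ?_ le_self_add
            rw [hG1, indicator_of_mem (show |x - y| ∈ Iic r from h)]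
            gcongr
          · refine le_trans ?_ le_add_self
            rw [hG2, indicator_of_mem (show |x - y| ∈ Ioi r from h),
              ← ENNReal.ofReal_mul (h0 y), ← ENNReal.ofReal_mul hc0.le,
              ← ENNReal.ofReal_mul (by positivity), ← ENNReal.ofReal_add]
            · exact ENNReal.ofReal_le_ofReal (young_ptw (h0 y) hc0 (abs_pos.2 hu))
            · have := h0 y
              positivity
            · positivity
        · rw [indicator_of_notMem (show y ∉ {y | f y ≤ v} from hfy)]
          exact zero_le
    _ = ENNReal.ofReal v * (∫⁻ y, G1 |x - y|) + (ENNReal.ofReal c * ENNReal.ofReal b +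
          ENNReal.ofReal ((c ^ 3)⁻¹) * (∫⁻ y, G2 |x - y|)) := by
        rw [lintegral_add_left (mG1'.const_mul _), lintegral_add_right _ (mG2'.const_mul _),
          lintegral_const_mul _ mG1', lintegral_const_mul _ mG2', lintegral_const_mul _ (by fun_prop), hB]
    _ ≤ ENNReal.ofReal v * ENNReal.ofReal (4 * r ^ (1 / 2 : ℝ)) + (ENNReal.ofReal c * ENNReal.ofReal b +
          ENNReal.ofReal ((c ^ 3)⁻¹) * ENNReal.ofReal (2 / r)) := by gcongr
    _ = ENNReal.ofReal (v * (4 * r ^ (1 / 2 : ℝ)) + (c * b + (c ^ 3)⁻¹ * (2 / r))) := by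
        rw [ENNReal.ofReal_add (by positivity) (by positivity),
          ENNReal.ofReal_add (by positivity) (by positivity), ENNReal.ofReal_mul hv.le,
          ENNReal.ofReal_mul hc0.le, ENNReal.ofReal_mul (by positivity : 0 ≤ (c ^ 3)⁻¹)]
    _ = _ := by
        congr 1
        rw [er, ev, eb, hr, hc]
        field_simp
        ring

lemma hls (f : ℝ → ℝ) (hf : Measurable f) (h0 : ∀ x, 0 ≤ f x) (b : ℝ) (hb : 0 ≤ b)
    (hB : ∫⁻ y, ENNReal.ofReal (f y ^ (4 / 3 : ℝ)) = ENNReal.ofReal b) :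
    ∫⁻ x, ∫⁻ y, ENNReal.ofReal (f x) * (ENNReal.ofReal (f y) * kk (x - y))
      ≤ ENNReal.ofReal (14 * b ^ (3 / 2 : ℝ)) := by
  have km := kk_meas
  rcases hb.eq_or_lt with hb0 | hb0
  · rw [← hb0, ENNReal.ofReal_zero, lintegral_eq_zero_iff (by fun_prop)] at hB
    have : ∫⁻ x, ∫⁻ y, ENNReal.ofReal (f x) * (ENNReal.ofReal (f y) * kk (x - y)) = 0 := by
      rw [lintegral_eq_zero_iff' ?_]
      · filter_upwards [hB] with x hx
        have h1 : f x ^ (4 / 3 : ℝ) ≤ 0 := by simpa using hx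
        have h2 : f x = 0 := by
          by_contra hne
          have : 0 < f x := lt_of_le_of_ne (h0 x) (Ne.symm hne)
          have : 0 < f x ^ (4 / 3 : ℝ) := by positivity
          linarith
        simp [h2]
      · apply Measurable.aemeasurable
        apply Measurable.lintegral_prod_right'
          (f := fun z : ℝ × ℝ => ENNReal.ofReal (f z.1) * (ENNReal.ofReal (f z.2) * kk (z.1 - z.2)))
        fun_prop
    rw [this]; exact zero_le
  set F : ℝ → ℝ → ℝ≥0∞ := fun x y => ENNReal.ofReal (f x) *
    ({y | f y ≤ f x}.indicator (fun y => ENNReal.ofReal (f y) * kk (x - y)) y) with hF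
  have mF : Measurable (Function.uncurry F) := by
    have : Function.uncurry F = {z : ℝ × ℝ | f z.2 ≤ f z.1}.indicator
        (fun z => ENNReal.ofReal (f z.1) * (ENNReal.ofReal (f z.2) * kk (z.1 - z.2))) := by
      ext z
      simp only [Function.uncurry, hF, indicator, mem_ofPred_eq]
      split_ifs <;> simp
    rw [this]
    refine Measurable.indicator (by fun_prop) ?_
    exact measurableSet_le (by fun_prop) (by fun_prop)
  have key : ∫⁻ x, ∫⁻ y, F x y ≤ ENNReal.ofReal (7 * b ^ (3 / 2 : ℝ)) := by
    calc ∫⁻ x, ∫⁻ y, F x y ≤ ∫⁻ x, ENNReal.ofReal (7 * b ^ (1 / 2 : ℝ)) *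
          ENNReal.ofReal (f x ^ (4 / 3 : ℝ)) := by
          refine lintegral_mono fun x => ?_
          simp only [hF]
          rw [lintegral_const_mul' _ _ ENNReal.ofReal_ne_top]
          rcases (h0 x).eq_or_lt with hx | hx
          · rw [← hx]; simp
          · refine (mul_le_mul_right (hls_inner f hf h0 b hb0 hB (f x) x hx) _).trans ?_
            rw [← ENNReal.ofReal_mul hx.le, ← ENNReal.ofReal_mul (by positivity)]
            apply ENNReal.ofReal_le_ofReal
            have : f x ^ (4 / 3 : ℝ) = f x * f x ^ (1 / 3 : ℝ) := by
              nth_rewrite 2 [← Real.rpow_one (f x)]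
              rw [← Real.rpow_add hx]; norm_num
            rw [this]
            apply le_of_eq; ring
      _ = _ := by
          rw [lintegral_const_mul _ (by fun_prop), hB, ← ENNReal.ofReal_mul (by positivity)]
          congr 1
          have : b ^ (3 / 2 : ℝ) = b ^ (1 / 2 : ℝ) * b := by
            nth_rewrite 3 [← Real.rpow_one b]
            rw [← Real.rpow_add hb0]; norm_num
          rw [this]; ring
  calc _ ≤ ∫⁻ x, ∫⁻ y, (F x y + F y x) := by
        refine lintegral_mono fun x => lintegral_mono fun y => ?_
        simp only [hF]
        rcases le_total (f y) (f x) with h | h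
        · refine le_trans ?_ le_self_add
          rw [indicator_of_mem (show y ∈ {y | f y ≤ f x} from h)]
        · refine le_trans ?_ le_add_self
          rw [indicator_of_mem (show x ∈ {z | f z ≤ f y} from h)]
          have : kk (x - y) = kk (y - x) := by unfold kk; rw [abs_sub_comm]
          rw [this]
          apply le_of_eq; ring
    _ = (∫⁻ x, ∫⁻ y, F x y) + ∫⁻ x, ∫⁻ y, F y x := by
        have mI : Measurable (fun x => ∫⁻ y, F x y) := mF.lintegral_prod_right'
        rw [← lintegral_add_left mI]
        refine lintegral_congr fun x => ?_
        rw [lintegral_add_left (mF.of_uncurry_left)]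
    _ = (∫⁻ x, ∫⁻ y, F x y) + ∫⁻ x, ∫⁻ y, F x y := by
        congr 1
        rw [lintegral_lintegral_swap]
        exact (mF.comp measurable_swap).aemeasurable
    _ ≤ ENNReal.ofReal (7 * b ^ (3 / 2 : ℝ)) + ENNReal.ofReal (7 * b ^ (3 / 2 : ℝ)) := by gcongr
    _ = _ := by
        rw [← ENNReal.ofReal_add (by positivity) (by positivity)]; congr 1; ring
lemma Adens_ge_one (mv mz : ℕ) {s : ℝ} (hs : 2 ≤ s) : 1 ≤ Adens mv mz s := by
  unfold Adens
  have h1 : 1 ≤ Real.sinh (s / 2) := le_trans (by linarith) (Real.self_le_sinh_iff.2 (by linarith : 0 ≤ s / 2))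
  have h2 := Real.one_le_cosh (s / 2)
  have a1 : (1 : ℝ) ≤ 2 ^ (mv + mz) := one_le_pow₀ (by norm_num)
  have a2 := one_le_pow₀ h1 (n := mv + mz)
  have a3 := one_le_pow₀ h2 (n := mz)
  exact one_le_mul_of_one_le_of_one_le (one_le_mul_of_one_le_of_one_le a1 a2) a3

lemma osc_eq (σ l s s' r r' : ℝ) :
    osc_s1 σ (s - s') (r - r') l = (((l ^ 2 + σ) ^ (-(1 / 4) : ℝ) : ℝ) : ℂ) *
      (Complex.exp (-(Complex.I * ((l * s + r * (l ^ 2 + σ) : ℝ) : ℂ))) *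
        (starRingEnd ℂ) (Complex.exp (-(Complex.I * ((l * s' + r' * (l ^ 2 + σ) : ℝ) : ℂ))))) := by
  unfold osc_s1
  rw [← Complex.exp_conj, ← Complex.exp_add]
  congr 2
  rw [map_neg, map_mul, Complex.conj_I, Complex.conj_ofReal]
  push_cast
  ring

lemma osc_meas (σ : ℝ) (t : ℝ → ℝ) (ht : Measurable t) :
    Measurable (fun z : ℝ × (ℝ × ℝ) => osc_s1 σ (z.2.1 - z.2.2) (t z.2.1 - t z.2.2) z.1) := by
  unfold osc_s1
  fun_prop

lemma trunc_bound {σ : ℝ} (hσ : 0 < σ) (t : ℝ → ℝ) (ht : Measurable t) (S : Set ℝ)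
    (g : ℝ → ℂ) (f : ℝ → ℝ) (hf : Measurable f) (hgm : Measurable g) (hgf : ∀ s, ‖g s‖ ≤ f s)
    (hgi : Integrable g (volume.restrict S)) (b : ℝ) (hb : 0 ≤ b)
    (hB : ∫⁻ y, ENNReal.ofReal (f y ^ (4 / 3 : ℝ)) = ENNReal.ofReal b)
    (a N : ℝ) (ha : 0 < a) (haN : a ≤ N) :
    ∫ l in a..N, (l ^ 2 + σ) ^ (-(1 / 4) : ℝ) * ‖∫ s in S, g s *
      Complex.exp (-(Complex.I * ((l * s + t s * (l ^ 2 + σ) : ℝ) : ℂ)))‖ ^ 2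
      ≤ 364 * b ^ (3 / 2 : ℝ) := by
  set μ := volume.restrict S with hμ
  set E : ℝ → ℝ → ℂ := fun l s =>
    Complex.exp (-(Complex.I * ((l * s + t s * (l ^ 2 + σ) : ℝ) : ℂ))) with hE
  set G : ℝ × ℝ → ℂ := fun z => g z.1 * (starRingEnd ℂ) (g z.2) with hG
  set O : ℝ → ℝ × ℝ → ℂ := fun l z => osc_s1 σ (z.1 - z.2) (t z.1 - t z.2) l with hO
  have h0 : ∀ s, 0 ≤ f s := fun s => (norm_nonneg _).trans (hgf s)
  have hGi : Integrable G (μ.prod μ) := by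
    have hconj : Integrable (fun s => (starRingEnd ℂ) (g s)) μ :=
      Complex.conjLIE.toContinuousLinearEquiv.toContinuousLinearMap.integrable_comp hgi
    exact hgi.mul_prod hconj
  have step1 : ∀ l, (((l ^ 2 + σ) ^ (-(1 / 4) : ℝ) * ‖∫ s in S, g s * E l s‖ ^ 2 : ℝ) : ℂ)
      = ∫ z, O l z * G z ∂(μ.prod μ) := by
    intro l
    have e1 : ((‖∫ s in S, g s * E l s‖ ^ 2 : ℝ) : ℂ) =
        (∫ s, g s * E l s ∂μ) * ∫ s, (starRingEnd ℂ) (g s * E l s) ∂μ := by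
      rw [integral_conj, Complex.mul_conj, Complex.normSq_eq_norm_sq]
    rw [Complex.ofReal_mul, e1, ← integral_prod_mul, ← integral_const_mul]
    refine integral_congr_ae (Eventually.of_forall fun z => ?_)
    simp only [hO, hG, osc_eq, hE, map_mul]
    ring
  have hOb : ∀ l z, ‖O l z‖ ≤ σ ^ (-(1 / 4) : ℝ) := by
    intro l z
    simp only [hO]
    rw [norm_osc hσ]
    exact Real.rpow_le_rpow_of_nonpos hσ (by nlinarith [sq_nonneg l]) (by norm_num)
  have hOm : Measurable (Function.uncurry O) := osc_meas σ t ht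
  have hint : Integrable (Function.uncurry fun l z => O l z * G z)
      ((volume.restrict (Ioc a N)).prod (μ.prod μ)) := by
    have hG2 : Integrable (fun z : ℝ × (ℝ × ℝ) => G z.2)
        ((volume.restrict (Ioc a N)).prod (μ.prod μ)) := hGi.comp_snd _
    refine hG2.bdd_mul (c := σ ^ (-(1 / 4) : ℝ)) hOm.aestronglyMeasurable ?_
    exact Eventually.of_forall fun z => hOb _ _
  have step2 : ((∫ l in a..N, (l ^ 2 + σ) ^ (-(1 / 4) : ℝ) * ‖∫ s in S, g s * E l s‖ ^ 2 : ℝ) : ℂ)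
      = ∫ z, (∫ l in a..N, O l z) * G z ∂(μ.prod μ) := by
    rw [← intervalIntegral.integral_ofReal, intervalIntegral.integral_of_le haN]
    simp_rw [step1]
    rw [integral_integral_swap hint]
    refine integral_congr_ae (Eventually.of_forall fun z => ?_)
    simp only
    rw [integral_mul_const, intervalIntegral.integral_of_le haN]
  have kb : ∀ z : ℝ × ℝ, ‖∫ l in a..N, O l z‖ₑ ≤ 26 * kk (z.1 - z.2) := by
    intro z
    by_cases hz : z.1 - z.2 = 0
    · have : kk (z.1 - z.2) = ⊤ := by
        unfold kk; rw [hz]; simp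
      rw [this, ENNReal.mul_top (by norm_num)]
      exact le_top
    · rw [kk_ne hz, show (26 : ENNReal) = ENNReal.ofReal 26 by simp, ← ENNReal.ofReal_mul (by norm_num),
        ← ofReal_norm]
      exact ENNReal.ofReal_le_ofReal (ker_bound hσ _ _ a N hz ha haN)
  have km := kk_meas
  have gb : ∀ s, ‖g s‖ₑ ≤ ENNReal.ofReal (f s) := by
    intro s
    rw [← ofReal_norm]
    exact ENNReal.ofReal_le_ofReal (hgf s)
  have step3 : ‖∫ z, (∫ l in a..N, O l z) * G z ∂(μ.prod μ)‖ₑ ≤ ENNReal.ofReal (364 * b ^ (3 / 2 : ℝ)) := by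
    calc _ ≤ ∫⁻ z, ‖(∫ l in a..N, O l z) * G z‖ₑ ∂(μ.prod μ) := enorm_integral_le_lintegral_enorm _
      _ ≤ ∫⁻ z, 26 * (ENNReal.ofReal (f z.1) * (ENNReal.ofReal (f z.2) * kk (z.1 - z.2))) ∂(μ.prod μ) := by
          refine lintegral_mono fun z => ?_
          simp only [hG]
          rw [enorm_mul, enorm_mul, RCLike.enorm_conj]
          calc _ ≤ 26 * kk (z.1 - z.2) * (ENNReal.ofReal (f z.1) * ENNReal.ofReal (f z.2)) :=
                mul_le_mul' (kb z) (mul_le_mul' (gb _) (gb _))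
            _ = _ := by ring
      _ = 26 * ∫⁻ x, ∫⁻ y, ENNReal.ofReal (f x) * (ENNReal.ofReal (f y) * kk (x - y)) ∂μ ∂μ := by
          rw [lintegral_const_mul _ (by fun_prop), lintegral_prod _ (by fun_prop)]
      _ ≤ 26 * ∫⁻ x, ∫⁻ y, ENNReal.ofReal (f x) * (ENNReal.ofReal (f y) * kk (x - y)) := by
          gcongr <;> exact Measure.restrict_le_self
      _ ≤ 26 * ENNReal.ofReal (14 * b ^ (3 / 2 : ℝ)) := by
          gcongr
          exact hls f hf h0 b hb hB
      _ = _ := by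
          rw [show (26 : ENNReal) = ENNReal.ofReal 26 by simp, ← ENNReal.ofReal_mul (by norm_num)]
          congr 1; ring
  rw [← step2, ← ofReal_norm, Complex.norm_real] at step3
  have := (ENNReal.ofReal_le_ofReal_iff (by positivity)).1 step3
  exact (le_abs_self _).trans this

theorem dual_annulus_estimate (mv mz : ℕ) (hmv : 0 < mv) (hmz : 0 < mz) :
    ∃ R₀ : ℝ, 2 < R₀ ∧ ∀ R : ℝ, R₀ < R → ∃ C : ℝ, 0 < C ∧
      ∀ t : ℝ → ℝ, Measurable t →
        (∀ s ∈ Set.Ioo R₀ R, t s ∈ Set.Ioo 0 (1 / rhoDR mv mz ^ 2)) →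
      ∀ h : ℝ → ℂ, ContDiff ℝ (⊤ : ℕ∞) h → tsupport h ⊆ Set.Ioo R₀ R →
      (∫ l in Set.Ioi (1 / R₀),
        (l ^ 2 + rhoDR mv mz ^ 2) ^ (-(1 / 4) : ℝ) *
          ‖∫ s in Set.Ioo R₀ R,
            ((Adens mv mz s ^ (-(1 / 4) : ℝ) : ℝ) : ℂ)
              * Complex.exp (-(Complex.I *
                  ((l * s + t s * (l ^ 2 + rhoDR mv mz ^ 2) : ℝ) : ℂ)))
              * h s‖ ^ 2)
        ≤ C * (∫ s in Set.Ioo R₀ R, ‖h s‖ ^ ((4 : ℝ) / 3)) ^ ((3 : ℝ) / 2) := by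
  refine ⟨3, by norm_num, fun R hR => ⟨364, by norm_num, fun t ht _ h hh hsupp => ?_⟩⟩
  have hρ : 0 < rhoDR mv mz := by
    unfold rhoDR
    have : (0 : ℝ) < mv := by exact_mod_cast hmv
    have : (0 : ℝ) < mz := by exact_mod_cast hmz
    positivity
  set σ := rhoDR mv mz ^ 2 with hσd
  have hσ : 0 < σ := by positivity
  have hc : Continuous h := hh.continuous
  have hcs : HasCompactSupport h :=
    Metric.isCompact_of_isClosed_isBounded (isClosed_tsupport h) ((Metric.isBounded_Ioo 3 R).subset hsupp)
  have hz : ∀ s, s ∉ Ioo 3 R → h s = 0 := fun s hs => by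
    by_contra hne
    exact hs (hsupp (subset_tsupport h hne))
  set g : ℝ → ℂ := fun s => ((Adens mv mz s ^ (-(1 / 4) : ℝ) : ℝ) : ℂ) * h s with hg
  have hAm : Measurable (Adens mv mz) := by
    unfold Adens
    apply Continuous.measurable
    fun_prop
  have hgm : Measurable g := by
    have := hc.measurable
    simp only [hg]
    fun_prop
  have hgf : ∀ s, ‖g s‖ ≤ ‖h s‖ := by
    intro s
    by_cases hs : s ∈ Ioo 3 R
    · have h1 : 1 ≤ Adens mv mz s := Adens_ge_one mv mz (by linarith [hs.1])
      simp only [hg]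
      rw [norm_mul, Complex.norm_real, Real.norm_eq_abs, abs_of_nonneg (by positivity)]
      refine mul_le_of_le_one_left (norm_nonneg _) ?_
      exact Real.rpow_le_one_of_one_le_of_nonpos h1 (by norm_num)
    · simp [hg, hz s hs]
  have hgi : Integrable g := (hc.integrable_of_hasCompactSupport hcs).mono hgm.aestronglyMeasurable
    (Eventually.of_forall hgf)
  set b := ∫ s in Set.Ioo 3 R, ‖h s‖ ^ ((4 : ℝ) / 3) with hb
  have hb0 : 0 ≤ b := integral_nonneg fun s => by positivity
  have hbfull : b = ∫ s, ‖h s‖ ^ ((4 : ℝ) / 3) := by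
    rw [hb]
    refine setIntegral_eq_integral_of_forall_compl_eq_zero fun s hs => ?_
    rw [hz s hs, norm_zero, Real.zero_rpow (by norm_num)]
  have hB : ∫⁻ y, ENNReal.ofReal (‖h y‖ ^ (4 / 3 : ℝ)) = ENNReal.ofReal b := by
    rw [hbfull, ofReal_integral_eq_lintegral_ofReal]
    · apply Continuous.integrable_of_hasCompactSupport
      · exact hc.norm.rpow_const fun _ => Or.inr (by norm_num)
      · exact hcs.comp_left (g := fun z : ℂ => ‖z‖ ^ ((4 : ℝ) / 3)) (by
          rw [norm_zero, Real.zero_rpow (by norm_num)])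
    · exact Eventually.of_forall fun s => by positivity
  have hre : ∀ l s : ℝ, ((Adens mv mz s ^ (-(1 / 4) : ℝ) : ℝ) : ℂ)
              * Complex.exp (-(Complex.I * ((l * s + t s * (l ^ 2 + σ) : ℝ) : ℂ))) * h s
      = g s * Complex.exp (-(Complex.I * ((l * s + t s * (l ^ 2 + σ) : ℝ) : ℂ))) := by
    intro l s; simp only [hg]; ring
  simp_rw [hre]
  set Φ : ℝ → ℝ := fun l => (l ^ 2 + σ) ^ (-(1 / 4) : ℝ) * ‖∫ s in Ioo 3 R, g s *
      Complex.exp (-(Complex.I * ((l * s + t s * (l ^ 2 + σ) : ℝ) : ℂ)))‖ ^ 2 with hΦ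
  by_cases hΦi : IntegrableOn Φ (Ioi (1 / 3))
  · refine le_of_tendsto (intervalIntegral_tendsto_integral_Ioi (1 / 3) hΦi tendsto_id) ?_
    filter_upwards [eventually_ge_atTop (1 / 3)] with N hN
    exact trunc_bound hσ t ht (Ioo 3 R) g (fun s => ‖h s‖) hc.norm.measurable hgm hgf
      hgi.restrict b hb0 hB (1 / 3) N (by norm_num) hN
  · rw [integral_undef hΦi]
    positivity
end
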